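/- For any continuous path of Lagrangian subspaces L of a real symplectic vector space (E, ω) on [a,b], the intersection number of L with the constant path at its final point equals its intersection number with the constant path at its initial point: [L : const_{L(b)}] = [L : const_{L(a)}], where const_M denotes the constant path t ↦ M on [a,b]. -/

import Mathlib

open LinearMap (BilinForm)

variable {E : Type*} [NormedAddCommGroup E] [NormedSpace ℝ E]

/-- A subspace is Lagrangian iff it equals its symplectic orthogonal. -/
def IsLagrangian (ω : BilinForm ℝ E) (L : Submodule ℝ E) : Prop :=
  LinearMap.BilinForm.orthogonal ω L = L

/-- Maximal dimension of a subspace on which the function `Q` is positive away from `0`. -/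
noncomputable def posIndex {V : Type*} [AddCommGroup V] [Module ℝ V] (Q : V → ℝ) : ℕ :=
  sSup {d : ℕ | ∃ W : Submodule ℝ V, Module.finrank ℝ W = d ∧ ∀ x ∈ W, x ≠ 0 → 0 < Q x}

/-- The quadratic form `Q(L1,L2,L3)` of a triplet of subspaces,
`Q(x1,x2,x3) = ω(x1,x2) + ω(x2,x3) + ω(x3,x1)`. -/
def tripleQ (ω : BilinForm ℝ E) (L1 L2 L3 : Submodule ℝ E) (v : L1 × L2 × L3) : ℝ :=
  ω v.1 v.2.1 + ω v.2.1 v.2.2 + ω v.2.2 v.1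

/-- The signature `s(L1,L2,L3)` of a triplet of subspaces: the signature (number of positive
squares minus number of negative squares in a diagonalization) of `Q(L1,L2,L3)`. -/
noncomputable def tripleSig (ω : BilinForm ℝ E) (L1 L2 L3 : Submodule ℝ E) : ℤ :=
  (posIndex (tripleQ ω L1 L2 L3) : ℤ) - (posIndex (fun v => - tripleQ ω L1 L2 L3 v) : ℤ)

/-- A continuous path of Lagrangian subspaces of `(E, ω)` on the interval `[a,b]`:  a family
`(L t)` of Lagrangian subspaces such that every `t0 ∈ [a,b]` has a neighbourhood `U` in `[a,b]`
on which there is a continuous family of idempotent linear maps of `E` with range `L t`. -/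
structure IsLagrangianPath (ω : BilinForm ℝ E) (a b : ℝ) (L : ℝ → Submodule ℝ E) : Prop where
  lag : ∀ t ∈ Set.Icc a b, IsLagrangian ω (L t)
  locTriv : ∀ t0 ∈ Set.Icc a b, ∃ U ∈ nhdsWithin t0 (Set.Icc a b), U ⊆ Set.Icc a b ∧
    ∃ P : ℝ → E →L[ℝ] E, ContinuousOn P U ∧
      ∀ t ∈ U, (P t).comp (P t) = P t ∧ LinearMap.range (P t : E →ₗ[ℝ] E) = L t

/-- A jointly continuous two-parameter family `(L s t)`, `s ∈ [0,1]`, `t ∈ [a,b]`, of Lagrangian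
subspaces (a homotopy of paths of Lagrangian subspaces). -/
structure IsLagrangianHomotopy (ω : BilinForm ℝ E) (a b : ℝ)
    (L : ℝ → ℝ → Submodule ℝ E) : Prop where
  lag : ∀ s ∈ Set.Icc (0:ℝ) 1, ∀ t ∈ Set.Icc a b, IsLagrangian ω (L s t)
  locTriv : ∀ p ∈ Set.Icc (0:ℝ) 1 ×ˢ Set.Icc a b,
    ∃ U ∈ nhdsWithin p (Set.Icc (0:ℝ) 1 ×ˢ Set.Icc a b),
      U ⊆ Set.Icc (0:ℝ) 1 ×ˢ Set.Icc a b ∧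
      ∃ P : ℝ × ℝ → E →L[ℝ] E, ContinuousOn P U ∧
        ∀ q ∈ U, (P q).comp (P q) = P q ∧ LinearMap.range (P q : E →ₗ[ℝ] E) = L q.1 q.2

/-- Admissible data for a pair of paths of Lagrangian subspaces on `[a,b]`:  a partition
`a = t_0 ≤ t_1 ≤ … ≤ t_k = b` together with Lagrangian subspaces `M_1, …, M_k` such that
`M_ν ∩ L_i(t) = 0` for all `t ∈ [t_{ν-1}, t_ν]`, `i = 1,2`.  (Here `M (ν+1)` plays the role
of `M_{ν+1}` for `0 ≤ ν < k`.) -/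
structure AdmissibleData (ω : BilinForm ℝ E) (a b : ℝ) (L1 L2 : ℝ → Submodule ℝ E) where
  k : ℕ
  kpos : 0 < k
  t : ℕ → ℝ
  M : ℕ → Submodule ℝ E
  ht0 : t 0 = a
  htk : t k = b
  hmono : ∀ ν < k, t ν ≤ t (ν + 1)
  hlag : ∀ ν < k, IsLagrangian ω (M (ν + 1))
  htrans1 : ∀ ν < k, ∀ s ∈ Set.Icc (t ν) (t (ν + 1)), M (ν + 1) ⊓ L1 s = ⊥
  htrans2 : ∀ ν < k, ∀ s ∈ Set.Icc (t ν) (t (ν + 1)), M (ν + 1) ⊓ L2 s = ⊥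

/-- The expression `(1/2) Σ_ν ( s(L1(t_{ν-1}), L2(t_{ν-1}), M_ν) − s(L1(t_ν), L2(t_ν), M_ν) )`
computed from admissible data; by well-definedness this is the intersection number `[L1 : L2]`. -/
noncomputable def dataSum {ω : BilinForm ℝ E} {a b : ℝ} {L1 L2 : ℝ → Submodule ℝ E}
    (D : AdmissibleData ω a b L1 L2) : ℝ :=
  (1 / 2 : ℝ) * ∑ ν ∈ Finset.range D.k,
    ((tripleSig ω (L1 (D.t ν)) (L2 (D.t ν)) (D.M (ν + 1)) : ℝ)
      - (tripleSig ω (L1 (D.t (ν + 1))) (L2 (D.t (ν + 1))) (D.M (ν + 1)) : ℝ))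

/-- A continuous path of symplectic automorphisms of `(E, ω)` on `[a,b]`. -/
structure IsSymplecticPath (ω : BilinForm ℝ E) (a b : ℝ) (A : ℝ → E →L[ℝ] E) : Prop where
  bij : ∀ t ∈ Set.Icc a b, Function.Bijective (A t)
  symp : ∀ t ∈ Set.Icc a b, ∀ x y, ω (A t x) (A t y) = ω x y
  cont : ContinuousOn A (Set.Icc a b)

/-- The symplectic form of `E × E⁻`: `((x1,x2),(y1,y2)) ↦ ω(x1,y1) − ω(x2,y2)`. -/
noncomputable def prodNegForm (ω : BilinForm ℝ E) : BilinForm ℝ (E × E) :=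
  LinearMap.mk₂ ℝ (fun x y => ω x.1 y.1 - ω x.2 y.2)
    (fun x x' y => by simp only [Prod.fst_add, Prod.snd_add, map_add, LinearMap.add_apply]; ring)
    (fun c x y => by
      simp only [Prod.smul_fst, Prod.smul_snd, map_smul, LinearMap.smul_apply, smul_eq_mul]; ring)
    (fun x y y' => by simp only [Prod.fst_add, Prod.snd_add, map_add]; ring)
    (fun c x y => by simp only [Prod.smul_fst, Prod.smul_snd, map_smul, smul_eq_mul]; ring)

/-- The graph `Γ_A = {(A x, x)}` of an endomorphism, as a subspace of `E × E`. -/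
def graphSub (A : E →L[ℝ] E) : Submodule ℝ (E × E) :=
  LinearMap.range ((A : E →ₗ[ℝ] E).prod LinearMap.id)

/-- The diagonal `Δ = {(x, x)}` in `E × E`. -/
def diagSub : Submodule ℝ (E × E) :=
  LinearMap.range ((LinearMap.id : E →ₗ[ℝ] E).prod LinearMap.id)

section Signature

open QuadraticMap QuadraticForm Module

variable {V V' : Type*} [AddCommGroup V] [Module ℝ V] [AddCommGroup V'] [Module ℝ V']

theorem posIndex_eq_sigPos [FiniteDimensional ℝ V] (Q : QuadraticForm ℝ V) :
    posIndex Q = sigPos Q := by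
  refine IsGreatest.csSup_eq ?_
  have h (W : Submodule ℝ V) : (∀ x ∈ W, x ≠ 0 → 0 < Q x) ↔ (Q.restrict W).PosDef :=
    ⟨fun h x hx => h x x.2 fun h0 => hx (by simpa using h0),
      fun h x hx h0 => h ⟨x, hx⟩ fun h1 => h0 (by simpa using h1)⟩
  simpa only [h] using sigPos_isGreatest Q

/-- The signature of a real quadratic form. -/
noncomputable def signature (Q : QuadraticForm ℝ V) : ℤ := (sigPos Q : ℤ) - sigNeg Q

theorem signature_neg (Q : QuadraticForm ℝ V) : signature (-Q) = -signature Q := by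
  simp [signature]

theorem finrank_le_sigPos [FiniteDimensional ℝ V] (Q : QuadraticForm ℝ V) {U : Type*}
    [AddCommGroup U] [Module ℝ U] [FiniteDimensional ℝ U] (f : U →ₗ[ℝ] V)
    (hf : ∀ x, x ≠ 0 → 0 < Q (f x)) : finrank ℝ U ≤ sigPos Q := by
  have hinj : Function.Injective f := by
    rw [← LinearMap.ker_eq_bot, Submodule.eq_bot_iff]
    intro x hx
    by_contra h
    have := hf x h
    rw [LinearMap.mem_ker.mp hx, map_zero] at this
    exact lt_irrefl _ this
  rw [← LinearMap.finrank_range_of_inj hinj]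
  apply le_sigPos_of_posDef
  rintro ⟨_, x, rfl⟩ hx
  exact hf x fun h => hx (by simp [h])

theorem exists_posDef_subspace [FiniteDimensional ℝ V] (Q : QuadraticForm ℝ V) :
    ∃ W : Submodule ℝ V, finrank ℝ W = sigPos Q ∧ ∀ x : W, x ≠ 0 → 0 < Q x :=
  exists_finrank_eq_sigPos_and_posDef Q

theorem sigPos_comp_of_surjective [FiniteDimensional ℝ V] [FiniteDimensional ℝ V']
    (Q : QuadraticForm ℝ V') (f : V →ₗ[ℝ] V') (hf : Function.Surjective f) :
    sigPos (Q.comp f) = sigPos Q := by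
  apply le_antisymm
  · obtain ⟨W, hW, hpos⟩ := exists_posDef_subspace (Q.comp f)
    rw [← hW]
    exact finrank_le_sigPos Q (f ∘ₗ W.subtype) hpos
  · obtain ⟨W, hW, hpos⟩ := exists_posDef_subspace Q
    obtain ⟨g, hg⟩ := f.exists_rightInverse_of_surjective (LinearMap.range_eq_top.mpr hf)
    rw [← hW]
    refine finrank_le_sigPos _ (g ∘ₗ W.subtype) fun x hx => ?_
    have : f (g x) = x := LinearMap.congr_fun hg x
    simpa [this] using hpos x hx

theorem signature_comp_of_surjective [FiniteDimensional ℝ V] [FiniteDimensional ℝ V']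
    (Q : QuadraticForm ℝ V') (f : V →ₗ[ℝ] V') (hf : Function.Surjective f) :
    signature (Q.comp f) = signature Q := by
  have h : -(Q.comp f) = (-Q).comp f := by ext; simp
  rw [signature, signature, sigPos_comp_of_surjective Q f hf, ← sigPos_neg, ← sigPos_neg, h,
    sigPos_comp_of_surjective (-Q) f hf]

theorem sigPos_add_le_sigPos_prod [FiniteDimensional ℝ V] [FiniteDimensional ℝ V']
    (Q : QuadraticForm ℝ V) (Q' : QuadraticForm ℝ V') :
    sigPos Q + sigPos Q' ≤ sigPos (Q.prod Q') := by
  obtain ⟨W, hW, hpos⟩ := exists_posDef_subspace Q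
  obtain ⟨W', hW', hpos'⟩ := exists_posDef_subspace Q'
  rw [← hW, ← hW', ← finrank_prod]
  refine finrank_le_sigPos _ (W.subtype.prodMap W'.subtype) ?_
  rintro ⟨x, y⟩ hxy
  simp only [LinearMap.prodMap_apply, Submodule.subtype_apply, QuadraticMap.prod_apply]
  by_cases hx : x = 0
  · have hy : y ≠ 0 := by rintro rfl; exact hxy (by simp [hx])
    simpa [hx] using hpos' y hy
  · by_cases hy : y = 0
    · simpa [hy] using hpos x hx
    · exact add_pos (hpos x hx) (hpos' y hy)

theorem signature_prod [FiniteDimensional ℝ V] [FiniteDimensional ℝ V']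
    (Q : QuadraticForm ℝ V) (Q' : QuadraticForm ℝ V') :
    signature (Q.prod Q') = signature Q + signature Q' := by
  have h1 := sigPos_add_le_sigPos_prod Q Q'
  have h2 := sigPos_add_le_sigPos_prod (-Q) (-Q')
  have hneg : (-Q).prod (-Q') = -(Q.prod Q') := by ext; simp; ring
  rw [hneg, sigPos_neg, sigPos_neg, sigPos_neg] at h2
  have h3 : finrank ℝ Q.radical + finrank ℝ Q'.radical ≤ finrank ℝ (Q.prod Q').radical := by
    rw [← finrank_prod]
    let j : Q.radical × Q'.radical →ₗ[ℝ] V × V' := Q.radical.subtype.prodMap Q'.radical.subtype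
    have hj : Function.Injective j :=
      Q.radical.injective_subtype.prodMap Q'.radical.injective_subtype
    rw [← LinearMap.finrank_range_of_inj hj]
    apply Submodule.finrank_mono
    rintro _ ⟨⟨⟨x, hx⟩, ⟨y, hy⟩⟩, rfl⟩
    rw [mem_radical_iff'] at hx hy
    rw [mem_radical_iff']
    simp [j, hx.1, hx.2, hy.1, hy.2]
  have e := sigPos_add_sigNeg_add_radical (Q := Q)
  have e' := sigPos_add_sigNeg_add_radical (Q := Q')
  have e'' := sigPos_add_sigNeg_add_radical (Q := Q.prod Q')
  rw [finrank_prod] at e''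
  simp only [signature]
  omega

/-- Restricting a form to a subspace lowers `sigPos` by at most the codimension. -/
theorem sigPos_le_sigPos_restrict_add [FiniteDimensional ℝ V] (Q : QuadraticForm ℝ V)
    (U : Submodule ℝ V) :
    sigPos Q + finrank ℝ U ≤ sigPos (Q.comp U.subtype) + finrank ℝ V := by
  obtain ⟨W, hW, hpos⟩ := exists_posDef_subspace Q
  have h1 : finrank ℝ ↥(W ⊓ U) ≤ sigPos (Q.comp U.subtype) := by
    refine finrank_le_sigPos _ (Submodule.inclusion (inf_le_right : W ⊓ U ≤ U)) fun x hx => ?_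
    exact hpos ⟨x, x.2.1⟩ fun h => hx (by simpa using h)
  have h2 := Submodule.finrank_sup_add_finrank_inf_eq W U
  have h3 := Submodule.finrank_le (W ⊔ U)
  omega

/-- The signature of a form is that of its restriction to a coisotropic subspace. -/
theorem signature_restrict_of_coisotropic [FiniteDimensional ℝ V] (Q : QuadraticForm ℝ V)
    (U : Submodule ℝ V) (hU : LinearMap.BilinForm.orthogonal Q.polarBilin U ≤ U) :
    signature (Q.comp U.subtype) = signature Q := by
  have : Invertible (2 : ℝ) := invertibleOfNonzero two_ne_zero
  have h1 := sigPos_le_sigPos_restrict_add Q U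
  have h2 := sigPos_le_sigPos_restrict_add (-Q) U
  have hneg : (-Q).comp U.subtype = -(Q.comp U.subtype) := by ext; simp
  rw [hneg, sigPos_neg, sigPos_neg] at h2
  have h3 : finrank ℝ (LinearMap.BilinForm.orthogonal Q.polarBilin U) ≤
      finrank ℝ (Q.comp U.subtype).radical := by
    rw [← Submodule.finrank_map_subtype_eq U (Q.comp U.subtype).radical]
    apply Submodule.finrank_mono
    intro x hx
    refine ⟨⟨x, hU hx⟩, ?_, rfl⟩
    rw [SetLike.mem_coe, radical_eq_ker_polarBilin, LinearMap.mem_ker]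
    refine LinearMap.ext fun y => ?_
    have := hx y y.2
    rw [polarBilin_apply_apply, polar_comm] at this
    simpa [polar] using this
  have h4 := LinearMap.BilinForm.finrank_add_finrank_orthogonal' (B := Q.polarBilin) U
  have h5 : finrank ℝ ↥(U ⊓ Q.polarBilin.ker) = finrank ℝ Q.radical := by
    rw [radical_eq_ker_polarBilin, inf_eq_right.mpr]
    intro x hx
    apply hU
    intro y _
    rw [polarBilin_apply_apply, polar_comm,
      ← polarBilin_apply_apply, LinearMap.mem_ker.mp hx, LinearMap.zero_apply]
  have e := sigPos_add_sigNeg_add_radical (Q := Q)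
  have e' := sigPos_add_sigNeg_add_radical (Q := Q.comp U.subtype)
  have := Submodule.finrank_le U
  simp only [signature]
  omega

/-- Isotropic reduction: the signature of `Q` can be computed after pulling back along a map onto
the orthogonal of an isotropic subspace. -/
theorem signature_comp_of_range_eq_orthogonal [FiniteDimensional ℝ V] [FiniteDimensional ℝ V']
    (Q : QuadraticForm ℝ V') (W : Submodule ℝ V')
    (hW : W ≤ LinearMap.BilinForm.orthogonal Q.polarBilin W) (f : V →ₗ[ℝ] V')
    (hf : LinearMap.range f = LinearMap.BilinForm.orthogonal Q.polarBilin W) :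
    signature (Q.comp f) = signature Q := by
  rw [← signature_restrict_of_coisotropic Q (LinearMap.range f)
    (hf ▸ LinearMap.BilinForm.orthogonal_le hW),
    ← signature_comp_of_surjective _ f.rangeRestrict f.surjective_rangeRestrict]
  rfl

end Signature

section TripleSignature

open QuadraticMap QuadraticForm

/-- The quadratic form `x ↦ ω (f x) (g x)`. -/
noncomputable def pairForm {V : Type*} [AddCommGroup V] [Module ℝ V] (ω : BilinForm ℝ E)
    (f g : V →ₗ[ℝ] E) : QuadraticForm ℝ V :=
  LinearMap.BilinMap.toQuadraticMap (ω.compl₁₂ f g)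

section PairForm

variable {V : Type*} [AddCommGroup V] [Module ℝ V] (ω : BilinForm ℝ E) (f g : V →ₗ[ℝ] E)

@[simp] theorem pairForm_apply (x : V) : pairForm ω f g x = ω (f x) (g x) := rfl

@[simp] theorem polar_pairForm (x y : V) :
    polar (pairForm ω f g) x y = ω (f x) (g y) + ω (f y) (g x) := by
  simp only [polar, pairForm_apply, map_add, LinearMap.add_apply]
  ring

end PairForm

namespace IsLagrangian

variable {ω : BilinForm ℝ E} {L L' : Submodule ℝ E}

theorem apply_eq_zero (h : IsLagrangian ω L) {x y : E} (hx : x ∈ L) (hy : y ∈ L) : ω x y = 0 := by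
  rw [IsLagrangian] at h
  rw [← h] at hy
  exact hy x hx

theorem mem_of_forall (h : IsLagrangian ω L) {y : E} (hy : ∀ x ∈ L, ω x y = 0) : y ∈ L := by
  rw [IsLagrangian] at h
  rw [← h]
  exact hy

theorem orthogonal_inf [FiniteDimensional ℝ E] (halt : ω.IsAlt) (hnd : ω.Nondegenerate)
    (h : IsLagrangian ω L) (h' : IsLagrangian ω L') :
    LinearMap.BilinForm.orthogonal ω (L ⊓ L') = L ⊔ L' := by
  rw [← LinearMap.BilinForm.orthogonal_orthogonal hnd halt.isRefl (L ⊔ L')]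
  congr 1
  apply le_antisymm
  · rintro x ⟨hx, hx'⟩ y hy
    obtain ⟨u, hu, v, hv, rfl⟩ := Submodule.mem_sup.mp hy
    rw [map_add, LinearMap.add_apply, h.apply_eq_zero hu hx, h'.apply_eq_zero hv hx', add_zero]
  · intro x hx
    exact ⟨h.mem_of_forall fun y hy => hx y (Submodule.mem_sup_left hy),
      h'.mem_of_forall fun y hy => hx y (Submodule.mem_sup_right hy)⟩

theorem finrank_eq [FiniteDimensional ℝ E] (hnd : ω.Nondegenerate)
    (h : IsLagrangian ω L) (h' : IsLagrangian ω L') :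
    Module.finrank ℝ L = Module.finrank ℝ L' := by
  have e := LinearMap.BilinForm.finrank_orthogonal hnd L
  have e' := LinearMap.BilinForm.finrank_orthogonal hnd L'
  have hL := Submodule.finrank_le L
  have hL' := Submodule.finrank_le L'
  rw [IsLagrangian] at h h'
  rw [h] at e
  rw [h'] at e'
  omega

end IsLagrangian

/-- `tripleQ` as a quadratic form. -/
noncomputable def tripleForm (ω : BilinForm ℝ E) (L₁ L₂ L₃ : Submodule ℝ E) :
    QuadraticForm ℝ (L₁ × L₂ × L₃) :=
  let p₁ := L₁.subtype ∘ₗ LinearMap.fst ℝ L₁ (L₂ × L₃)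
  let p₂ := L₂.subtype ∘ₗ LinearMap.fst ℝ L₂ L₃ ∘ₗ LinearMap.snd ℝ L₁ (L₂ × L₃)
  let p₃ := L₃.subtype ∘ₗ LinearMap.snd ℝ L₂ L₃ ∘ₗ LinearMap.snd ℝ L₁ (L₂ × L₃)
  pairForm ω p₁ p₂ + pairForm ω p₂ p₃ + pairForm ω p₃ p₁

@[simp] theorem tripleForm_apply (ω : BilinForm ℝ E) (L₁ L₂ L₃ : Submodule ℝ E)
    (v : L₁ × L₂ × L₃) :
    tripleForm ω L₁ L₂ L₃ v = ω v.1 v.2.1 + ω v.2.1 v.2.2 + ω v.2.2 v.1 := rfl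

@[simp] theorem polar_tripleForm (ω : BilinForm ℝ E) (L₁ L₂ L₃ : Submodule ℝ E)
    (v w : L₁ × L₂ × L₃) :
    polar (tripleForm ω L₁ L₂ L₃) v w =
      ω v.1 w.2.1 + ω w.1 v.2.1 + (ω v.2.1 w.2.2 + ω w.2.1 v.2.2) +
        (ω v.2.2 w.1 + ω w.2.2 v.1) := by
  simp only [tripleForm, FunLike.coe_add, polar_add, polar_pairForm]
  rfl

/-- The space of pairs `(x₁, x₂) ∈ L₁ × L₂` with `x₁ + x₂ ∈ L₃`. -/
def gluing₃ (L₁ L₂ L₃ : Submodule ℝ E) : Submodule ℝ (E × E) :=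
  L₁.comap (LinearMap.fst ℝ E E) ⊓ L₂.comap (LinearMap.snd ℝ E E) ⊓
    L₃.comap (LinearMap.fst ℝ E E + LinearMap.snd ℝ E E)

theorem mem_gluing₃ {L₁ L₂ L₃ : Submodule ℝ E} {p : E × E} :
    p ∈ gluing₃ L₁ L₂ L₃ ↔ (p.1 ∈ L₁ ∧ p.2 ∈ L₂) ∧ p.1 + p.2 ∈ L₃ := Iff.rfl

/-- The quadratic form `(x₁, x₂) ↦ ω x₁ x₂` on `gluing₃ L₁ L₂ L₃`. -/
noncomputable def gluingForm₃ (ω : BilinForm ℝ E) (L₁ L₂ L₃ : Submodule ℝ E) :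
    QuadraticForm ℝ (gluing₃ L₁ L₂ L₃) :=
  (pairForm ω (LinearMap.fst ℝ E E) (LinearMap.snd ℝ E E)).comp (gluing₃ L₁ L₂ L₃).subtype

@[simp] theorem gluingForm₃_apply (ω : BilinForm ℝ E) (L₁ L₂ L₃ : Submodule ℝ E)
    (v : gluing₃ L₁ L₂ L₃) : gluingForm₃ ω L₁ L₂ L₃ v = ω v.1.1 v.1.2 := rfl

/-- The space of triples `(x₁, x₂, x₃) ∈ L₁ × L₂ × L₃` with `x₁ + x₂ + x₃ ∈ L₄`. -/
def gluing₄ (L₁ L₂ L₃ L₄ : Submodule ℝ E) : Submodule ℝ (E × E × E) :=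
  L₁.comap (LinearMap.fst ℝ E (E × E)) ⊓
    (L₂.prod L₃).comap (LinearMap.snd ℝ E (E × E)) ⊓
    L₄.comap (LinearMap.fst ℝ E (E × E) +
      (LinearMap.fst ℝ E E + LinearMap.snd ℝ E E) ∘ₗ LinearMap.snd ℝ E (E × E))

theorem mem_gluing₄ {L₁ L₂ L₃ L₄ : Submodule ℝ E} {p : E × E × E} :
    p ∈ gluing₄ L₁ L₂ L₃ L₄ ↔
      (p.1 ∈ L₁ ∧ p.2.1 ∈ L₂ ∧ p.2.2 ∈ L₃) ∧ p.1 + (p.2.1 + p.2.2) ∈ L₄ := Iff.rfl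

/-- The quadratic form `(x₁, x₂, x₃) ↦ ω x₁ x₂ + ω x₁ x₃ + ω x₂ x₃` on
`gluing₄ L₁ L₂ L₃ L₄`. -/
noncomputable def gluingForm₄ (ω : BilinForm ℝ E) (L₁ L₂ L₃ L₄ : Submodule ℝ E) :
    QuadraticForm ℝ (gluing₄ L₁ L₂ L₃ L₄) :=
  let p₁ := LinearMap.fst ℝ E (E × E)
  let p₂ := LinearMap.fst ℝ E E ∘ₗ LinearMap.snd ℝ E (E × E)
  let p₃ := LinearMap.snd ℝ E E ∘ₗ LinearMap.snd ℝ E (E × E)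
  let i := (gluing₄ L₁ L₂ L₃ L₄).subtype
  pairForm ω (p₁ ∘ₗ i) (p₂ ∘ₗ i) + pairForm ω (p₁ ∘ₗ i) (p₃ ∘ₗ i) + pairForm ω (p₂ ∘ₗ i) (p₃ ∘ₗ i)

@[simp] theorem gluingForm₄_apply (ω : BilinForm ℝ E) (L₁ L₂ L₃ L₄ : Submodule ℝ E)
    (v : gluing₄ L₁ L₂ L₃ L₄) :
    gluingForm₄ ω L₁ L₂ L₃ L₄ v = ω v.1.1 v.1.2.1 + ω v.1.1 v.1.2.2 + ω v.1.2.1 v.1.2.2 := rfl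

@[simp] theorem polar_gluingForm₄ (ω : BilinForm ℝ E) (L₁ L₂ L₃ L₄ : Submodule ℝ E)
    (v w : gluing₄ L₁ L₂ L₃ L₄) :
    polar (gluingForm₄ ω L₁ L₂ L₃ L₄) v w =
      ω v.1.1 w.1.2.1 + ω w.1.1 v.1.2.1 + (ω v.1.1 w.1.2.2 + ω w.1.1 v.1.2.2) +
        (ω v.1.2.1 w.1.2.2 + ω w.1.2.1 v.1.2.2) := by
  simp only [gluingForm₄, FunLike.coe_add, polar_add, polar_pairForm]
  rfl

variable [FiniteDimensional ℝ E] {ω : BilinForm ℝ E} {L₁ L₂ L₃ L₄ : Submodule ℝ E}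

theorem tripleSig_eq_signature (ω : BilinForm ℝ E) (L₁ L₂ L₃ : Submodule ℝ E) :
    tripleSig ω L₁ L₂ L₃ = signature (tripleForm ω L₁ L₂ L₃) := by
  rw [tripleSig, signature, ← sigPos_neg, ← posIndex_eq_sigPos, ← posIndex_eq_sigPos]
  rfl

theorem tripleSig_rotate (ω : BilinForm ℝ E) (L₁ L₂ L₃ : Submodule ℝ E) :
    tripleSig ω L₂ L₃ L₁ = tripleSig ω L₁ L₂ L₃ := by
  rw [tripleSig_eq_signature, tripleSig_eq_signature]
  let e : (L₁ × L₂ × L₃) →ₗ[ℝ] (L₂ × L₃ × L₁) :=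
    ((LinearMap.fst ℝ L₂ L₃) ∘ₗ LinearMap.snd ℝ L₁ (L₂ × L₃)).prod
      (((LinearMap.snd ℝ L₂ L₃) ∘ₗ LinearMap.snd ℝ L₁ (L₂ × L₃)).prod
        (LinearMap.fst ℝ L₁ (L₂ × L₃)))
  rw [← signature_comp_of_surjective (tripleForm ω L₂ L₃ L₁) e
    fun v => ⟨(v.2.2, v.1, v.2.1), rfl⟩]
  congr 1
  ext v
  simp [e]
  ring

theorem tripleSig_swap (halt : ω.IsAlt) (L₁ L₂ L₃ : Submodule ℝ E) :
    tripleSig ω L₂ L₁ L₃ = -tripleSig ω L₁ L₂ L₃ := by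
  rw [tripleSig_eq_signature, tripleSig_eq_signature, ← signature_neg]
  let e : (L₁ × L₂ × L₃) →ₗ[ℝ] (L₂ × L₁ × L₃) :=
    ((LinearMap.fst ℝ L₂ L₃) ∘ₗ LinearMap.snd ℝ L₁ (L₂ × L₃)).prod
      ((LinearMap.fst ℝ L₁ (L₂ × L₃)).prod
        ((LinearMap.snd ℝ L₂ L₃) ∘ₗ LinearMap.snd ℝ L₁ (L₂ × L₃)))
  rw [← signature_comp_of_surjective (tripleForm ω L₂ L₁ L₃) e
    fun v => ⟨(v.2.1, v.1, v.2.2), rfl⟩]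
  congr 1
  ext v
  have h₁ := LinearMap.IsAlt.neg halt v.1 v.2.1
  have h₂ := LinearMap.IsAlt.neg halt v.2.1 v.2.2
  have h₃ := LinearMap.IsAlt.neg halt v.2.2 v.1
  change ω v.2.1 v.1 + ω v.1 v.2.2 + ω v.2.2 v.2.1 =
    -(ω v.1 v.2.1 + ω v.2.1 v.2.2 + ω v.2.2 v.1)
  linarith

theorem tripleSig_self_left (halt : ω.IsAlt) (L₁ L₂ : Submodule ℝ E) :
    tripleSig ω L₁ L₁ L₂ = 0 := by
  have := tripleSig_swap halt L₁ L₁ L₂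
  omega

theorem tripleSig_eq_neg_signature_gluingForm₃ (halt : ω.IsAlt) (h₃ : IsLagrangian ω L₃) :
    tripleSig ω L₁ L₂ L₃ = -signature (gluingForm₃ ω L₁ L₂ L₃) := by
  rw [tripleSig_eq_signature, ← signature_neg]
  have hL (v : gluing₃ L₁ L₂ L₃) := mem_gluing₃.mp v.2
  let i := (gluing₃ L₁ L₂ L₃).subtype
  let f₁ : gluing₃ L₁ L₂ L₃ →ₗ[ℝ] L₁ := (LinearMap.fst ℝ E E ∘ₗ i).codRestrict L₁ fun v => (hL v).1.1
  let f₂ : gluing₃ L₁ L₂ L₃ →ₗ[ℝ] L₂ := (LinearMap.snd ℝ E E ∘ₗ i).codRestrict L₂ fun v => (hL v).1.2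
  have hf₁ (v : gluing₃ L₁ L₂ L₃) : (f₁ v : E) = v.1.1 := rfl
  have hf₂ (v : gluing₃ L₁ L₂ L₃) : (f₂ v : E) = v.1.2 := rfl
  let f : (gluing₃ L₁ L₂ L₃ × L₃) →ₗ[ℝ] (L₁ × L₂ × L₃) :=
    (f₁ ∘ₗ LinearMap.fst ℝ _ _).prod
      ((-f₂ ∘ₗ LinearMap.fst ℝ _ _).prod (LinearMap.snd ℝ _ _))
  let W : Submodule ℝ (L₁ × L₂ × L₃) :=
    LinearMap.range (LinearMap.inr ℝ L₁ (L₂ × L₃) ∘ₗ LinearMap.inr ℝ L₂ L₃)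
  have hmem (v : L₁ × L₂ × L₃) :
      v ∈ LinearMap.BilinForm.orthogonal (tripleForm ω L₁ L₂ L₃).polarBilin W ↔
        (v.1 - v.2.1 : E) ∈ L₃ := by
    have hpol (x : L₃) : (tripleForm ω L₁ L₂ L₃).polarBilin (0, 0, x) v = ω x (v.1 - v.2.1 : E) := by
      have := LinearMap.IsAlt.neg halt v.2.1 (x : E)
      simp
      linarith
    constructor
    · intro hv
      refine h₃.mem_of_forall fun x hx => ?_
      rw [← hpol ⟨x, hx⟩]
      exact hv _ ⟨⟨x, hx⟩, rfl⟩
    · rintro hv _ ⟨x, rfl⟩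
      exact (hpol x).trans (h₃.apply_eq_zero x.2 hv)
  rw [← signature_comp_of_range_eq_orthogonal (tripleForm ω L₁ L₂ L₃) W _ f,
    ← signature_comp_of_surjective (-gluingForm₃ ω L₁ L₂ L₃) (LinearMap.fst ℝ _ L₃)
      LinearMap.fst_surjective]
  · congr 1
    ext v
    have h := h₃.apply_eq_zero v.2.2 (hL v.1).2
    have h' := LinearMap.IsAlt.neg halt v.1.1.2 (v.2 : E)
    simp only [map_add] at h
    simp [f, hf₁, hf₂]
    linarith
  · ext v
    rw [hmem]
    constructor
    · rintro ⟨w, rfl⟩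
      simpa [f, hf₁, hf₂] using (hL w.1).2
    · intro hv
      refine ⟨(⟨(v.1, -v.2.1), mem_gluing₃.mpr ⟨⟨v.1.2, neg_mem v.2.1.2⟩, ?_⟩⟩, v.2.2), ?_⟩
      · simpa [sub_eq_add_neg] using hv
      · ext <;> simp [f, hf₁, hf₂]
  · rintro _ ⟨x, rfl⟩
    rw [hmem]
    simp

theorem signature_gluingForm₄_rotate (halt : ω.IsAlt) (L₁ L₂ L₃ L₄ : Submodule ℝ E) :
    signature (gluingForm₄ ω L₂ L₃ L₄ L₁) = signature (gluingForm₄ ω L₁ L₂ L₃ L₄) := by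
  have hL (v : gluing₄ L₁ L₂ L₃ L₄) := mem_gluing₄.mp v.2
  let i := (gluing₄ L₁ L₂ L₃ L₄).subtype
  let p₁ := LinearMap.fst ℝ E (E × E)
  let p₂ := LinearMap.fst ℝ E E ∘ₗ LinearMap.snd ℝ E (E × E)
  let p₃ := LinearMap.snd ℝ E E ∘ₗ LinearMap.snd ℝ E (E × E)
  let f : gluing₄ L₁ L₂ L₃ L₄ →ₗ[ℝ] gluing₄ L₂ L₃ L₄ L₁ :=
    ((p₂.prod (p₃.prod (-(p₁ + (p₂ + p₃))))) ∘ₗ i).codRestrict _ fun v => by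
      refine mem_gluing₄.mpr ⟨⟨(hL v).1.2.1, (hL v).1.2.2, neg_mem (hL v).2⟩, ?_⟩
      convert neg_mem (hL v).1.1 using 1
      simp [i, p₁, p₂, p₃]
      abel
  rw [← signature_comp_of_surjective (gluingForm₄ ω L₂ L₃ L₄ L₁) f]
  · congr 1
    ext v
    have h₁ := LinearMap.IsAlt.neg halt v.1.1 v.1.2.1
    have h₂ := LinearMap.IsAlt.neg halt v.1.1 v.1.2.2
    have h₃ := LinearMap.IsAlt.neg halt v.1.2.1 v.1.2.2
    have h₄ := halt v.1.2.1
    have h₅ := halt v.1.2.2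
    simp [f, i, p₁, p₂, p₃]
    linarith
  · intro v
    have hv := mem_gluing₄.mp v.2
    refine ⟨⟨(-(v.1.1 + (v.1.2.1 + v.1.2.2)), v.1.1, v.1.2.1), mem_gluing₄.mpr
      ⟨⟨neg_mem hv.2, hv.1.1, hv.1.2.1⟩, ?_⟩⟩, ?_⟩
    · convert neg_mem hv.1.2.2 using 1
      simp
    · ext <;> simp [f, i, p₁, p₂, p₃]

theorem signature_gluingForm₄ (halt : ω.IsAlt) (hnd : ω.Nondegenerate)
    (h₁ : IsLagrangian ω L₁) (h₃ : IsLagrangian ω L₃) :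
    signature (gluingForm₄ ω L₁ L₂ L₃ L₄) =
      signature (gluingForm₃ ω L₁ L₂ L₃) + signature (gluingForm₃ ω L₁ L₃ L₄) := by
  have hU (v : gluing₃ L₁ L₂ L₃) := mem_gluing₃.mp v.2
  have hU' (v : gluing₃ L₁ L₃ L₄) := mem_gluing₃.mp v.2
  let p := (gluing₃ L₁ L₂ L₃).subtype ∘ₗ LinearMap.fst ℝ _ (gluing₃ L₁ L₃ L₄)
  let q := (gluing₃ L₁ L₃ L₄).subtype ∘ₗ LinearMap.snd ℝ (gluing₃ L₁ L₂ L₃) _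
  let x₁ := LinearMap.fst ℝ E E ∘ₗ p
  let x₂ := LinearMap.snd ℝ E E ∘ₗ p
  let y₁ := LinearMap.fst ℝ E E ∘ₗ q
  let y₃ := LinearMap.snd ℝ E E ∘ₗ q
  let f : (gluing₃ L₁ L₂ L₃ × gluing₃ L₁ L₃ L₄) →ₗ[ℝ] gluing₄ L₁ L₂ L₃ L₄ :=
    ((x₁ + y₁).prod (x₂.prod (y₃ - (x₁ + x₂)))).codRestrict _ fun v => by
      refine mem_gluing₄.mpr ⟨⟨add_mem (hU v.1).1.1 (hU' v.2).1.1, (hU v.1).1.2,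
        sub_mem (hU' v.2).1.2 (hU v.1).2⟩, ?_⟩
      convert (hU' v.2).2 using 1
      simp [x₁, x₂, y₁, y₃, p, q]
      abel
  let W : Submodule ℝ (gluing₄ L₁ L₂ L₃ L₄) :=
    LinearMap.range (((L₁ ⊓ L₃).subtype.prod (LinearMap.prod 0 (-(L₁ ⊓ L₃).subtype))).codRestrict
      (gluing₄ L₁ L₂ L₃ L₄) fun k => mem_gluing₄.mpr
        ⟨⟨k.2.1, zero_mem _, neg_mem k.2.2⟩, by simp⟩)
  have hmem (v : gluing₄ L₁ L₂ L₃ L₄) :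
      v ∈ LinearMap.BilinForm.orthogonal (gluingForm₄ ω L₁ L₂ L₃ L₄).polarBilin W ↔
        v.1.2.1 ∈ L₁ ⊔ L₃ := by
    have hv := mem_gluing₄.mp v.2
    rw [← h₁.orthogonal_inf halt hnd h₃]
    have hpol (k : E) (hk : k ∈ L₁ ⊓ L₃) (hk' : (k, 0, -k) ∈ gluing₄ L₁ L₂ L₃ L₄) :
        (gluingForm₄ ω L₁ L₂ L₃ L₄).polarBilin ⟨(k, 0, -k), hk'⟩ v = 2 * ω k v.1.2.1 := by
      have e₁ := h₁.apply_eq_zero hv.1.1 hk.1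
      have e₃ := h₃.apply_eq_zero hk.2 hv.1.2.2
      have e := LinearMap.IsAlt.neg halt v.1.2.1 k
      simp
      linarith
    constructor
    · intro hv k hk
      have := hv _ ⟨⟨k, hk⟩, rfl⟩
      have h := (hpol k hk _).symm.trans this
      simpa using h
    · rintro hv _ ⟨k, rfl⟩
      refine (hpol k k.2 _).trans ?_
      rw [hv k k.2, mul_zero]
  rw [← signature_comp_of_range_eq_orthogonal (gluingForm₄ ω L₁ L₂ L₃ L₄) W _ f, ← signature_prod]
  · congr 1
    ext v
    have e₁ := h₁.apply_eq_zero (hU v.1).1.1 (hU' v.2).1.1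
    have e₃ := h₃.apply_eq_zero (hU v.1).2 (hU' v.2).1.2
    have e₂ := LinearMap.IsAlt.neg halt v.1.1.1 v.1.1.2
    have e₄ := LinearMap.IsAlt.neg halt v.1.1.1 v.2.1.1
    have e₅ := halt v.1.1.1
    have e₆ := halt v.1.1.2
    simp only [map_add, LinearMap.add_apply] at e₃
    simp [f, x₁, x₂, y₁, y₃, p, q]
    linarith
  · ext v
    rw [hmem]
    constructor
    · rintro ⟨w, rfl⟩
      have h := add_mem (Submodule.mem_sup_left (neg_mem (hU w.1).1.1))
        (Submodule.mem_sup_right (S := L₁) (hU w.1).2)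
      simpa [f, x₁, x₂, y₁, y₃, p, q] using h
    · intro hv
      obtain ⟨u, hu, c, hc, huc⟩ := Submodule.mem_sup.mp hv
      have hv := mem_gluing₄.mp v.2
      refine ⟨(⟨(-u, v.1.2.1), mem_gluing₃.mpr ⟨⟨neg_mem hu, hv.1.2.1⟩, ?_⟩⟩,
        ⟨(v.1.1 + u, v.1.2.2 + c), mem_gluing₃.mpr ⟨⟨add_mem hv.1.1 hu, add_mem hv.1.2.2 hc⟩,
          ?_⟩⟩), ?_⟩
      · simpa [← huc] using hc
      · convert hv.2 using 1
        simp only [← huc]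
        abel
      · ext <;> simp [f, x₁, x₂, y₁, y₃, p, q, ← huc]
  · rintro _ ⟨k, rfl⟩
    rw [hmem]
    exact zero_mem _

/-- The cocycle property of the signature of a triplet of Lagrangian subspaces. -/
theorem tripleSig_cocycle (halt : ω.IsAlt) (hnd : ω.Nondegenerate)
    (h₁ : IsLagrangian ω L₁) (h₂ : IsLagrangian ω L₂) (h₃ : IsLagrangian ω L₃)
    (h₄ : IsLagrangian ω L₄) :
    tripleSig ω L₁ L₂ L₃ + tripleSig ω L₁ L₃ L₄ = tripleSig ω L₂ L₃ L₄ + tripleSig ω L₁ L₂ L₄ := by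
  have h := signature_gluingForm₄_rotate halt L₁ L₂ L₃ L₄
  rw [signature_gluingForm₄ halt hnd h₁ h₃, signature_gluingForm₄ halt hnd h₂ h₄] at h
  rw [← tripleSig_rotate ω L₁ L₂ L₄]
  rw [tripleSig_eq_neg_signature_gluingForm₃ halt h₃, tripleSig_eq_neg_signature_gluingForm₃ halt h₄,
    tripleSig_eq_neg_signature_gluingForm₃ halt h₄, tripleSig_eq_neg_signature_gluingForm₃ halt h₁]
  omega

end TripleSignature

section Continuity

open QuadraticMap QuadraticForm Module

variable {ω : BilinForm ℝ E} {L M N : Submodule ℝ E}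

theorem finrank_radical_tripleForm (halt : ω.IsAlt) (hL : IsLagrangian ω L)
    (hM : IsLagrangian ω M) (hN : IsLagrangian ω N) (hML : M ⊓ L = ⊥) (hNL : N ⊓ L = ⊥) :
    finrank ℝ (tripleForm ω L M N).radical = finrank ℝ ↥(M ⊓ N) := by
  have : Invertible (2 : ℝ) := invertibleOfNonzero two_ne_zero
  let f : ↥(M ⊓ N) →ₗ[ℝ] L × M × N :=
    LinearMap.prod 0
      ((Submodule.inclusion inf_le_left).prod (Submodule.inclusion inf_le_right))
  have hf : Function.Injective f := fun k k' h => by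
    have := congrArg (fun v : L × M × N => (v.2.1 : E)) h
    exact Subtype.ext this
  have hrad : (tripleForm ω L M N).radical = LinearMap.range f := by
    rw [radical_eq_ker_polarBilin]
    apply le_antisymm
    · rintro ⟨⟨x, hx⟩, ⟨m, hm⟩, ⟨n, hn⟩⟩ hv
      have hpol (w : L × M × N) := LinearMap.congr_fun (LinearMap.mem_ker.mp hv) w
      simp only [polarBilin_apply_apply, polar_tripleForm, LinearMap.zero_apply] at hpol
      have h₁ : m - n ∈ L := hL.mem_of_forall fun y hy => by
        have := hpol (⟨y, hy⟩, 0, 0)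
        have e := LinearMap.IsAlt.neg halt y n
        simp at this ⊢
        linarith
      have h₂ : x - n ∈ M := hM.mem_of_forall fun y hy => by
        have := hpol (0, ⟨y, hy⟩, 0)
        have e := LinearMap.IsAlt.neg halt y x
        simp at this ⊢
        linarith
      have h₃ : x - m ∈ N := hN.mem_of_forall fun y hy => by
        have := hpol (0, 0, ⟨y, hy⟩)
        have e := LinearMap.IsAlt.neg halt y m
        simp at this ⊢
        linarith
      have k₁ : x + m - n = 0 := by
        rw [← Submodule.mem_bot ℝ, ← hML]
        refine Submodule.mem_inf.mpr ⟨?_, ?_⟩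
        · convert add_mem hm h₂ using 1
          abel
        · convert add_mem hx h₁ using 1
          abel
      have k₂ : x + n - m = 0 := by
        rw [← Submodule.mem_bot ℝ, ← hNL]
        refine Submodule.mem_inf.mpr ⟨?_, ?_⟩
        · convert add_mem hn h₃ using 1
          abel
        · convert sub_mem hx h₁ using 1
          abel
      have hx0 : x = 0 := by
        have : (2 : ℝ) • x = (x + m - n) + (x + n - m) := by rw [two_smul]; abel
        rw [k₁, k₂, add_zero] at this
        exact (smul_eq_zero.mp this).resolve_left two_ne_zero
      subst hx0
      rw [zero_add, sub_eq_zero] at k₁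
      subst k₁
      exact ⟨⟨m, hm, hn⟩, rfl⟩
    · rintro _ ⟨⟨k, hkM, hkN⟩, rfl⟩
      rw [LinearMap.mem_ker]
      refine LinearMap.ext fun w => ?_
      have e₁ := LinearMap.IsAlt.neg halt k w.1
      have e₂ := hM.apply_eq_zero w.2.1.2 hkM
      have e₃ := hN.apply_eq_zero hkN w.2.2.2
      rw [polarBilin_apply_apply, polar_tripleForm]
      simp [f]
      linarith
  rw [hrad, LinearMap.finrank_range_of_inj hf]

variable [FiniteDimensional ℝ E]

theorem continuous_bilinForm (ω : BilinForm ℝ E) : Continuous fun p : E × E => ω p.1 p.2 := by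
  let B : E →L[ℝ] E →L[ℝ] ℝ :=
    LinearMap.toContinuousLinearMap (LinearMap.toContinuousLinearMap.toLinearMap ∘ₗ ω)
  exact (B.continuous.comp continuous_fst).clm_apply continuous_snd

/-- Lower semicontinuity of the index of inertia of `c • tripleForm ω (L t) M N` in `t`. -/
theorem eventually_sigPos_le {a b : ℝ} {L : ℝ → Submodule ℝ E} (hL : IsLagrangianPath ω a b L)
    (M N : Submodule ℝ E) (c : ℝ) {t₀ : ℝ} (ht₀ : t₀ ∈ Set.Icc a b) :
    ∀ᶠ t in nhdsWithin t₀ (Set.Icc a b),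
      sigPos (c • tripleForm ω (L t₀) M N) ≤ sigPos (c • tripleForm ω (L t) M N) := by
  obtain ⟨U, hU, hUab, P, hP, hPL⟩ := hL.locTriv t₀ ht₀
  have ht₀U : t₀ ∈ U := mem_of_mem_nhdsWithin ht₀ hU
  obtain ⟨W, hW, hpos⟩ := exists_posDef_subspace (c • tripleForm ω (L t₀) M N)
  let g (t : ℝ) (v : W) : ℝ :=
    c * (ω (P t v.1.1) v.1.2.1 + ω v.1.2.1 v.1.2.2 + ω v.1.2.2 (P t v.1.1))
  have hfix (x : L t₀) : P t₀ x = x := by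
    obtain ⟨hidem, hrange⟩ := hPL t₀ ht₀U
    obtain ⟨y, hy⟩ : (x : E) ∈ LinearMap.range (P t₀ : E →ₗ[ℝ] E) := by
      rw [hrange]
      exact x.2
    rw [← hy]
    exact congrArg (fun A : E →L[ℝ] E => A y) hidem
  have hcont (v : W) : Filter.Tendsto (fun p : ℝ × W => g p.1 p.2)
      (nhdsWithin t₀ (Set.Icc a b) ×ˢ nhds v) (nhds (g t₀ v)) := by
    have hPt : Filter.Tendsto P (nhdsWithin t₀ (Set.Icc a b)) (nhds (P t₀)) :=
      (hP t₀ ht₀U).mono_left (nhdsWithin_le_iff.mpr hU)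
    have hv : Filter.Tendsto (fun p : ℝ × W => p.2) (nhdsWithin t₀ (Set.Icc a b) ×ˢ nhds v)
      (nhds v) := Filter.tendsto_snd
    have hx : Filter.Tendsto (fun p : ℝ × W => (p.2.1.1 : E))
        (nhdsWithin t₀ (Set.Icc a b) ×ˢ nhds v) (nhds v.1.1) :=
      (Continuous.tendsto (by fun_prop) v : Filter.Tendsto (fun w : W => (w.1.1 : E)) _ _).comp hv
    have hm : Filter.Tendsto (fun p : ℝ × W => (p.2.1.2.1 : E))
        (nhdsWithin t₀ (Set.Icc a b) ×ˢ nhds v) (nhds v.1.2.1) :=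
      (Continuous.tendsto (by fun_prop) v : Filter.Tendsto (fun w : W => (w.1.2.1 : E)) _ _).comp hv
    have hn : Filter.Tendsto (fun p : ℝ × W => (p.2.1.2.2 : E))
        (nhdsWithin t₀ (Set.Icc a b) ×ˢ nhds v) (nhds v.1.2.2) :=
      (Continuous.tendsto (by fun_prop) v : Filter.Tendsto (fun w : W => (w.1.2.2 : E)) _ _).comp hv
    have hP' : Filter.Tendsto (fun p : ℝ × W => P p.1) (nhdsWithin t₀ (Set.Icc a b) ×ˢ nhds v)
        (nhds (P t₀)) := hPt.comp Filter.tendsto_fst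
    have hPx : Filter.Tendsto (fun p : ℝ × W => P p.1 p.2.1.1)
        (nhdsWithin t₀ (Set.Icc a b) ×ˢ nhds v) (nhds (P t₀ v.1.1)) :=
      ((isBoundedBilinearMap_apply (𝕜 := ℝ) (E := E) (F := E)).continuous.tendsto
        (P t₀, (v.1.1 : E))).comp (hP'.prodMk_nhds hx)
    have hω {u w : ℝ × W → E} {u₀ w₀ : E} {l : Filter (ℝ × W)} (hu : Filter.Tendsto u l (nhds u₀))
        (hw : Filter.Tendsto w l (nhds w₀)) :
        Filter.Tendsto (fun p => ω (u p) (w p)) l (nhds (ω u₀ w₀)) :=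
      ((continuous_bilinForm ω).tendsto (u₀, w₀)).comp (hu.prodMk_nhds hw)
    exact (((hω hPx hm).add (hω hm hn)).add (hω hn hPx)).const_mul c
  have hpos₀ (v : W) (hv : v ≠ 0) : 0 < g t₀ v := by
    simp only [g, hfix]
    exact hpos v hv
  have hev : ∀ᶠ t in nhdsWithin t₀ (Set.Icc a b), ∀ v ∈ Metric.sphere (0 : W) 1, 0 < g t v := by
    have := (isCompact_sphere (0 : W) 1).mem_prod_nhdsSet_of_forall
      (l := nhdsWithin t₀ (Set.Icc a b)) (s := {p | 0 < g p.1 p.2}) fun v hv =>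
        (hcont v).eventually_const_lt (hpos₀ v (ne_zero_of_mem_unit_sphere ⟨v, hv⟩))
    rw [Filter.mem_prod_iff] at this
    obtain ⟨T, hT, S, hS, hTS⟩ := this
    filter_upwards [hT] with t ht v hv
    exact hTS (Set.mk_mem_prod ht (subset_of_mem_nhdsSet hS hv))
  filter_upwards [hev, hU] with t ht htU
  rw [← hW]
  let P' : L t₀ →ₗ[ℝ] L t := ((P t : E →ₗ[ℝ] E) ∘ₗ (L t₀).subtype).codRestrict (L t) fun x => by
    rw [← (hPL t htU).2]
    exact ⟨x, rfl⟩
  refine finrank_le_sigPos _ (P'.prodMap LinearMap.id ∘ₗ W.subtype) fun v hv => ?_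
  change 0 < g t v
  have hn : 0 < ‖v‖ := norm_pos_iff.mpr hv
  have h := ht (‖v‖⁻¹ • v) (by
    rw [mem_sphere_zero_iff_norm, norm_smul, norm_inv, norm_norm, inv_mul_cancel₀ hn.ne'])
  have hg : g t (‖v‖⁻¹ • v) = ‖v‖⁻¹ * ‖v‖⁻¹ * g t v := by
    simp [g]
    ring
  rw [hg] at h
  exact (mul_pos_iff_of_pos_left (by positivity)).mp h

/-- `tripleSig ω (L t) M N` is constant in `t` while `L t` stays transverse to `M` and `N`. -/
theorem tripleSig_eq_of_isPreconnected (halt : ω.IsAlt) (hnd : ω.Nondegenerate) {a b : ℝ}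
    {L : ℝ → Submodule ℝ E} (hL : IsLagrangianPath ω a b L) (hM : IsLagrangian ω M)
    (hN : IsLagrangian ω N) {S : Set ℝ} (hS : IsPreconnected S) (hSab : S ⊆ Set.Icc a b)
    (hML : ∀ t ∈ S, M ⊓ L t = ⊥) (hNL : ∀ t ∈ S, N ⊓ L t = ⊥) {x y : ℝ} (hx : x ∈ S)
    (hy : y ∈ S) : tripleSig ω (L x) M N = tripleSig ω (L y) M N := by
  refine hS.constant (f := fun t => tripleSig ω (L t) M N) (fun t₀ ht₀ => ?_) hx hy
  have hc : ContinuousWithinAt (fun _ : ℝ => tripleSig ω (L t₀) M N) S t₀ :=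
    continuousWithinAt_const
  refine hc.congr_of_eventuallyEq ?_ rfl
  have h₁ := eventually_sigPos_le hL M N 1 (hSab ht₀)
  have h₂ := eventually_sigPos_le hL M N (-1) (hSab ht₀)
  filter_upwards [nhdsWithin_mono t₀ hSab h₁, nhdsWithin_mono t₀ hSab h₂, self_mem_nhdsWithin]
    with t h₁ h₂ ht
  have hneg (t : ℝ) : (-1 : ℝ) • tripleForm ω (L t) M N = -tripleForm ω (L t) M N := by
    ext v
    simp only [smul_apply, neg_apply, neg_one_smul]
  rw [one_smul, one_smul] at h₁
  rw [hneg, hneg, sigPos_neg, sigPos_neg] at h₂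
  have e₀ := sigPos_add_sigNeg_add_radical (Q := tripleForm ω (L t₀) M N)
  have e := sigPos_add_sigNeg_add_radical (Q := tripleForm ω (L t) M N)
  have l₀ := hL.lag t₀ (hSab ht₀)
  have l := hL.lag t (hSab ht)
  rw [finrank_radical_tripleForm halt l₀ hM hN (hML _ ht₀) (hNL _ ht₀), finrank_prod] at e₀
  rw [finrank_radical_tripleForm halt l hM hN (hML _ ht) (hNL _ ht), finrank_prod] at e
  have := l₀.finrank_eq hnd l
  simp only [tripleSig_eq_signature, signature]
  omega

end Continuity

section Partition

variable {t : ℕ → ℝ} {k : ℕ}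

theorem partition_le (ht : ∀ ν < k, t ν ≤ t (ν + 1)) {i j : ℕ} (hij : i ≤ j) (hj : j ≤ k) :
    t i ≤ t j := by
  induction j, hij using Nat.le_induction with
  | base => exact le_rfl
  | succ j _ ih => exact (ih (by omega)).trans (ht j (by omega))

theorem Icc_partition_subset (ht : ∀ ν < k, t ν ≤ t (ν + 1)) {ν : ℕ} (hν : ν < k) :
    Set.Icc (t ν) (t (ν + 1)) ⊆ Set.Icc (t 0) (t k) :=
  Set.Icc_subset_Icc (partition_le ht ν.zero_le hν.le) (partition_le ht hν le_rfl)

/-- Functions on the pieces of a partition glue, up to additive constants. -/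
theorem exists_glue_increments (ht : ∀ ν < k, t ν ≤ t (ν + 1)) (g : ℕ → ℝ → ℤ) :
    ∃ G : ℝ → ℤ, ∀ ν < k, ∀ x ∈ Set.Icc (t ν) (t (ν + 1)), ∀ y ∈ Set.Icc (t ν) (t (ν + 1)),
      G x - G y = g ν x - g ν y := by
  induction k with
  | zero => exact ⟨0, by simp⟩
  | succ k ih =>
    obtain ⟨G, hG⟩ := ih fun ν hν => ht ν (by omega)
    refine ⟨fun x => if x ≤ t k then G x else g k x - g k (t k) + G (t k),
      fun ν hν x hx y hy => ?_⟩
    rcases Nat.lt_succ_iff_lt_or_eq.mp hν with h | rfl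
    · have hle : t (ν + 1) ≤ t k := partition_le ht h (by omega)
      simp only [if_pos (hx.2.trans hle), if_pos (hy.2.trans hle)]
      exact hG ν h x hx y hy
    · have key (z : ℝ) (hz : z ∈ Set.Icc (t ν) (t (ν + 1))) :
          (if z ≤ t ν then G z else g ν z - g ν (t ν) + G (t ν)) =
            g ν z - g ν (t ν) + G (t ν) := by
        split_ifs with h
        · rw [le_antisymm h hz.1]
          ring
        · rfl
      simp only [key x hx, key y hy]
      ring

/-- If two functions have the same increments on the traces of an order-connected set on the pieces
of a partition, they have the same increments on that set. -/
theorem increments_eq_of_partition (ht : ∀ ν < k, t ν ≤ t (ν + 1)) {S : Set ℝ} [S.OrdConnected]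
    {G h : ℝ → ℤ}
    (hGh : ∀ ν < k, ∀ x ∈ Set.Icc (t ν) (t (ν + 1)) ∩ S, ∀ y ∈ Set.Icc (t ν) (t (ν + 1)) ∩ S,
      G x - G y = h x - h y)
    {x y : ℝ} (hx : x ∈ Set.Icc (t 0) (t k) ∩ S) (hy : y ∈ Set.Icc (t 0) (t k) ∩ S) :
    G x - G y = h x - h y := by
  wlog hxy : x ≤ y generalizing x y
  · have := this hy hx (le_of_not_ge hxy)
    omega
  induction k generalizing x y with
  | zero =>
    rw [le_antisymm hxy (hy.1.2.trans hx.1.1)]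
    simp
  | succ k ih =>
    have ih := @ih (fun ν hν => ht ν (by omega)) (fun ν hν => hGh ν (by omega))
    rcases le_total y (t k) with hyk | hyk
    · exact ih ⟨⟨hx.1.1, hxy.trans hyk⟩, hx.2⟩ ⟨⟨hy.1.1, hyk⟩, hy.2⟩ hxy
    rcases le_total (t k) x with hxk | hxk
    · exact hGh k (by omega) x ⟨⟨hxk, hx.1.2⟩, hx.2⟩ y ⟨⟨hyk, hy.1.2⟩, hy.2⟩
    have hkS : t k ∈ S := Set.OrdConnected.out ‹_› hx.2 hy.2 ⟨hxk, hyk⟩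
    have h₁ := ih ⟨⟨hx.1.1, hxk⟩, hx.2⟩ ⟨⟨hx.1.1.trans hxk, le_rfl⟩, hkS⟩ hxk
    have h₂ := hGh k (by omega) (t k) ⟨⟨le_rfl, ht k (by omega)⟩, hkS⟩ y ⟨⟨hyk, hy.1.2⟩, hy.2⟩
    omega

/-- The sum of increments along a partition does not depend on the partition, when the increments
agree on intersections of pieces. -/
theorem sum_increments_eq {u : ℕ → ℝ} {l : ℕ} (ht : ∀ ν < k, t ν ≤ t (ν + 1))
    (hu : ∀ μ < l, u μ ≤ u (μ + 1)) (h0 : t 0 = u 0) (h1 : t k = u l) {g h : ℕ → ℝ → ℤ}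
    (hgh : ∀ ν < k, ∀ μ < l, ∀ x ∈ Set.Icc (t ν) (t (ν + 1)) ∩ Set.Icc (u μ) (u (μ + 1)),
      ∀ y ∈ Set.Icc (t ν) (t (ν + 1)) ∩ Set.Icc (u μ) (u (μ + 1)),
        g ν x - g ν y = h μ x - h μ y) :
    ∑ ν ∈ Finset.range k, (g ν (t ν) - g ν (t (ν + 1))) =
      ∑ μ ∈ Finset.range l, (h μ (u μ) - h μ (u (μ + 1))) := by
  obtain ⟨G, hG⟩ := exists_glue_increments ht g
  have e₁ : ∑ ν ∈ Finset.range k, (g ν (t ν) - g ν (t (ν + 1))) = G (t 0) - G (t k) := by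
    rw [← Finset.sum_range_sub' (fun i => G (t i))]
    refine Finset.sum_congr rfl fun ν hν => ?_
    have hν := Finset.mem_range.mp hν
    exact (hG ν hν _ (Set.left_mem_Icc.mpr (ht ν hν)) _ (Set.right_mem_Icc.mpr (ht ν hν))).symm
  rw [e₁, h0, h1, ← Finset.sum_range_sub' (fun i => G (u i))]
  refine Finset.sum_congr rfl fun μ hμ => ?_
  have hμ := Finset.mem_range.mp hμ
  have hsub := Icc_partition_subset hu hμ
  rw [← h0, ← h1] at hsub
  have hl := Set.left_mem_Icc.mpr (hu μ hμ)
  have hr := Set.right_mem_Icc.mpr (hu μ hμ)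
  refine increments_eq_of_partition ht (S := Set.Icc (u μ) (u (μ + 1))) (fun ν hν x hx y hy => ?_)
    ⟨hsub hl, hl⟩ ⟨hsub hr, hr⟩
  rw [hG ν hν x hx.1 y hy.1]
  exact hgh ν hν μ hμ x hx y hy

end Partition

/-- for a continuous path of Lagrangian subspaces `L` on `[a,b]`,
`[L : const_{L(b)}] = [L : const_{L(a)}]`, both intersection numbers computed from arbitrary
admissible data. -/
theorem intersection_number_const_endpoints [FiniteDimensional ℝ E]
    (ω : BilinForm ℝ E) (halt : LinearMap.IsAlt ω)
    (hnd : LinearMap.BilinForm.Nondegenerate ω)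
    (a b : ℝ) (hab : a ≤ b)
    (L : ℝ → Submodule ℝ E) (hL : IsLagrangianPath ω a b L)
    (Db : AdmissibleData ω a b L (fun _ => L b))
    (Da : AdmissibleData ω a b L (fun _ => L a)) :
    dataSum Db = dataSum Da := by
  have ha := hL.lag a ⟨le_rfl, hab⟩
  have hb := hL.lag b ⟨hab, le_rfl⟩
  have key := sum_increments_eq (g := fun ν x => tripleSig ω (L x) (L b) (Db.M (ν + 1)) +
      tripleSig ω (L x) (L a) (L b)) (h := fun μ x => tripleSig ω (L x) (L a) (Da.M (μ + 1)))
    Db.hmono Da.hmono (Db.ht0.trans Da.ht0.symm) (Db.htk.trans Da.htk.symm) ?_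
  · have htel := Finset.sum_range_sub' (fun i => tripleSig ω (L (Db.t i)) (L a) (L b)) Db.k
    rw [Db.ht0, Db.htk, tripleSig_self_left halt, tripleSig_rotate ω (L b) (L b) (L a),
      tripleSig_self_left halt, sub_zero] at htel
    simp only [add_sub_add_comm, Finset.sum_add_distrib, htel, add_zero] at key
    simp only [dataSum]
    congr 1
    exact_mod_cast key
  · intro ν hν μ hμ x hx y hy
    have hsub := Icc_partition_subset Db.hmono hν
    rw [Db.ht0, Db.htk] at hsub
    have hM := Db.hlag ν hν
    have hN := Da.hlag μ hμ
    have hlx := hL.lag x (hsub hx.1)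
    have hly := hL.lag y (hsub hy.1)
    have hxy := tripleSig_eq_of_isPreconnected halt hnd hL hM hN
      (S := Set.Icc (Db.t ν) (Db.t (ν + 1)) ∩ Set.Icc (Da.t μ) (Da.t (μ + 1)))
      (by rw [Set.Icc_inter_Icc]; exact isPreconnected_Icc) (Set.inter_subset_left.trans hsub)
      (fun t ht => Db.htrans1 ν hν t ht.1) (fun t ht => Da.htrans1 μ hμ t ht.2) hx hy
    have x₁ := tripleSig_cocycle halt hnd hlx hb hM hN
    have x₂ := tripleSig_cocycle halt hnd hlx ha hb hN
    have y₁ := tripleSig_cocycle halt hnd hly hb hM hN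
    have y₂ := tripleSig_cocycle halt hnd hly ha hb hN
    omega
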